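/- arXiv:1510.05948 — 2 statements merged into one kernel-verified Lean document; each statement's English description precedes it below -/
import Mathlib

section
/- Let n ≥ 1, let q be a positive integer, and let s, s' ∈ ℤⁿ with gcd(q, s₁, …, sₙ) = gcd(q, s'₁, …, s'ₙ) = 1. Let γ_{q,s} = diag(R(2πs₁/q), …, R(2πsₙ/q)) ∈ SO(2n) be the block-diagonal matrix built from the 2×2 rotation blocks R(2πs_j/q), and similarly γ_{q,s'}. Then the cyclic subgroups Γ_{q,s} = ⟨γ_{q,s}⟩ and Γ_{q,s'} = ⟨γ_{q,s'}⟩ are conjugate by an element of the full orthogonal group O(2n) if and only if there exist a permutation σ of {1, …, n}, signs ε₁, …, εₙ ∈ {±1}, and an integer ℓ coprime to q such that s_{σ(j)} ≡ ε_j ℓ s'_j (mod q) for all 1 ≤ j ≤ n. -/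
/-- The 2×2 rotation matrix `R(θ)` with rows `(cos θ, sin θ)` and `(-sin θ, cos θ)`. -/
noncomputable def rotBlock (θ : ℝ) : Matrix (Fin 2) (Fin 2) ℝ :=
  !![Real.cos θ, Real.sin θ; -Real.sin θ, Real.cos θ]

open Matrix Polynomial in
/-- Families whose diagonal matrices, each entry repeated twice, have the same characteristic
polynomial agree up to a permutation. -/
theorem exists_perm_of_charpoly_diagonal_eq {n : ℕ} (a b : Fin n → ℝ)
    (h : (diagonal fun p : Fin 2 × Fin n => a p.2).charpoly =
      (diagonal fun p : Fin 2 × Fin n => b p.2).charpoly) :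
    ∃ σ : Equiv.Perm (Fin n), ∀ j, a (σ j) = b j := by
  classical
  have key : ∀ (d : Fin n → ℝ) (c : ℝ),
      (diagonal fun p : Fin 2 × Fin n => d p.2).charpoly.roots.count c =
        2 * Fintype.card {i // d i = c} := by
    intro d c
    have hroots : (diagonal fun p : Fin 2 × Fin n => d p.2).charpoly.roots =
        Finset.univ.val.map fun p : Fin 2 × Fin n => d p.2 := by
      rw [charpoly_diagonal, ← roots_multiset_prod_X_sub_C (Finset.univ.val.map _),
        Multiset.map_map]
      rfl
    rw [hroots, Multiset.count_map, Fintype.card_subtype]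
    have hfilter : (Finset.univ.filter fun p : Fin 2 × Fin n => c = d p.2) =
        Finset.univ ×ˢ Finset.univ.filter fun i => d i = c := by
      ext p
      simp [eq_comm]
    rw [← Finset.filter_val, Finset.card_val, hfilter, Finset.card_product]
    simp
  have hcard : ∀ c, Fintype.card {i // b i = c} = Fintype.card {i // a i = c} := by
    intro c
    have := key a c
    rw [h, key b c] at this
    omega
  exact ⟨Equiv.ofFiberEquiv fun c => Fintype.equivOfCardEq (hcard c),
    fun j => Equiv.ofFiberEquiv_map _ j⟩

theorem rotBlock_mul (a b : ℝ) : rotBlock a * rotBlock b = rotBlock (a + b) := by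
  ext i j
  fin_cases i <;> fin_cases j <;>
    simp [rotBlock, Matrix.mul_apply, Real.cos_add, Real.sin_add] <;> ring

theorem rotBlock_zero : rotBlock 0 = 1 := by
  ext i j
  fin_cases i <;> fin_cases j <;> simp [rotBlock]

theorem rotBlock_pow (a : ℝ) (k : ℕ) : rotBlock a ^ k = rotBlock (k * a) := by
  induction k with
  | zero => simp [rotBlock_zero]
  | succ k ih =>
    rw [pow_succ, ih, rotBlock_mul]
    push_cast
    ring_nf

theorem rotBlock_add_transpose (a : ℝ) :
    rotBlock a + (rotBlock a).transpose = Matrix.diagonal fun _ => 2 * Real.cos a := by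
  ext i j
  fin_cases i <;> fin_cases j <;> simp [rotBlock] <;> ring

/-- Conjugating a rotation by `diag(1, ε)` with `ε = ±1` multiplies the angle by `ε`. -/
theorem diagonal_sign_conj_rotBlock {ε : ℤ} (hε : ε = 1 ∨ ε = -1) (a : ℝ) :
    Matrix.diagonal ![1, (ε : ℝ)] * rotBlock (ε * a) * Matrix.diagonal ![1, (ε : ℝ)] =
      rotBlock a := by
  rcases hε with rfl | rfl <;> ext i j <;> fin_cases i <;> fin_cases j <;>
    simp [rotBlock]

/-- The matrix `diag(R(2πs₁/q), …, R(2πsₙ/q))`. -/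
noncomputable def rotDiag {n : ℕ} (q : ℕ) (s : Fin n → ℤ) :
    Matrix (Fin 2 × Fin n) (Fin 2 × Fin n) ℝ :=
  Matrix.blockDiagonal fun i => rotBlock (2 * Real.pi * (s i : ℝ) / (q : ℝ))

theorem rotDiag_pow {n : ℕ} (q : ℕ) (s : Fin n → ℤ) (k : ℕ) :
    rotDiag q s ^ k = rotDiag q fun i => k * s i := by
  rw [rotDiag, rotDiag, ← Matrix.blockDiagonal_pow]
  congr 1
  ext1 i
  rw [Pi.pow_apply, rotBlock_pow]
  push_cast
  ring_nf

theorem rotBlock_eq_of_modEq {q : ℕ} (hq : 0 < q) {a b : ℤ} (h : a ≡ b [ZMOD q]) :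
    rotBlock (2 * Real.pi * (a : ℝ) / (q : ℝ)) = rotBlock (2 * Real.pi * (b : ℝ) / (q : ℝ)) := by
  obtain ⟨c, hc⟩ := h.symm.dvd
  have hq' : (q : ℝ) ≠ 0 := by positivity
  have ha : 2 * Real.pi * (a : ℝ) / q = 2 * Real.pi * (b : ℝ) / q + c * (2 * Real.pi) := by
    have : (a : ℝ) = b + q * c := by exact_mod_cast (by omega : a = b + q * c)
    rw [this]
    field_simp
  rw [ha, rotBlock, rotBlock, Real.cos_add_int_mul_two_pi, Real.sin_add_int_mul_two_pi]

theorem modEq_or_modEq_neg_of_cos_eq {q : ℕ} (hq : 0 < q) {a b : ℤ}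
    (h : Real.cos (2 * Real.pi * (a : ℝ) / (q : ℝ)) = Real.cos (2 * Real.pi * (b : ℝ) / (q : ℝ))) :
    a ≡ b [ZMOD q] ∨ a ≡ -b [ZMOD q] := by
  have hq' : (q : ℝ) ≠ 0 := by positivity
  have hpi := Real.pi_ne_zero
  obtain ⟨k, hk | hk⟩ := Real.cos_eq_cos_iff.1 h
  · left
    field_simp at hk
    have : (b : ℤ) = k * q + a := by exact_mod_cast (by linarith : (b : ℝ) = k * q + a)
    exact Int.modEq_iff_dvd.2 ⟨k, by linarith⟩
  · right
    field_simp at hk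
    have : (b : ℤ) = k * q - a := by exact_mod_cast (by linarith : (b : ℝ) = k * q - a)
    exact Int.modEq_iff_dvd.2 ⟨-k, by linarith⟩

theorem modEq_of_rotBlock_eq {q : ℕ} (hq : 0 < q) {a b : ℤ}
    (h : rotBlock (2 * Real.pi * (a : ℝ) / (q : ℝ)) =
      rotBlock (2 * Real.pi * (b : ℝ) / (q : ℝ))) : a ≡ b [ZMOD q] := by
  have hdiff : rotBlock (2 * Real.pi * ((a - b : ℤ) : ℝ) / (q : ℝ)) =
      rotBlock (2 * Real.pi * ((0 : ℤ) : ℝ) / (q : ℝ)) := by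
    have h1 := congrArg (· * rotBlock (-(2 * Real.pi * (b : ℝ) / (q : ℝ)))) h
    simp only [rotBlock_mul] at h1
    convert h1 using 2
    · push_cast
      ring
    · simp
  have hcos := congrFun (congrFun hdiff 0) 0
  simp only [rotBlock, Matrix.of_apply, Matrix.cons_val_zero] at hcos
  have := modEq_or_modEq_neg_of_cos_eq hq hcos
  rw [neg_zero, or_self] at this
  simpa using this.add_right b

theorem rotDiag_eq_iff {n q : ℕ} (hq : 0 < q) {s t : Fin n → ℤ} :
    rotDiag q s = rotDiag q t ↔ ∀ i, s i ≡ t i [ZMOD q] := by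
  rw [rotDiag, rotDiag, Matrix.blockDiagonal_inj, funext_iff]
  exact forall_congr' fun i => ⟨modEq_of_rotBlock_eq hq, rotBlock_eq_of_modEq hq⟩

theorem rotDiag_add_transpose {n : ℕ} (q : ℕ) (s : Fin n → ℤ) :
    rotDiag q s + (rotDiag q s).transpose =
      Matrix.diagonal fun p : Fin 2 × Fin n =>
        2 * Real.cos (2 * Real.pi * (s p.2 : ℝ) / (q : ℝ)) := by
  rw [rotDiag, Matrix.blockDiagonal_transpose, ← Matrix.blockDiagonal_add,
    ← Matrix.blockDiagonal_diagonal fun i _ => 2 * Real.cos (2 * Real.pi * (s i : ℝ) / (q : ℝ))]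
  congr 1
  ext1 i
  exact rotBlock_add_transpose _

theorem Matrix.inv_eq_transpose_of_mem_orthogonalGroup {m : Type*} [Fintype m] [DecidableEq m]
    {g : Matrix m m ℝ} (hg : g ∈ Matrix.orthogonalGroup m ℝ) : g⁻¹ = g.transpose :=
  Matrix.inv_eq_right_inv ((Matrix.mem_orthogonalGroup_iff m ℝ).1 hg)

theorem Matrix.conj_pow_of_mem_orthogonalGroup {m : Type*} [Fintype m] [DecidableEq m]
    {g : Matrix m m ℝ} (hg : g ∈ Matrix.orthogonalGroup m ℝ) (x : Matrix m m ℝ) (k : ℕ) :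
    (g * x * g⁻¹) ^ k = g * x ^ k * g⁻¹ := by
  have hdet : IsUnit g.det := Matrix.isUnit_det_of_right_inverse
    ((Matrix.mem_orthogonalGroup_iff m ℝ).1 hg)
  exact (Matrix.nonsingInvUnit g hdet).conj_pow x k

/-- Orthogonally conjugate block rotations have the same angles up to order and sign. -/
theorem exists_perm_modEq_of_conj {n q : ℕ} (hq : 0 < q) {s t : Fin n → ℤ}
    {g : Matrix (Fin 2 × Fin n) (Fin 2 × Fin n) ℝ}
    (hg : g ∈ Matrix.orthogonalGroup (Fin 2 × Fin n) ℝ)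
    (h : g * rotDiag q s * g⁻¹ = rotDiag q t) :
    ∃ σ : Equiv.Perm (Fin n), ∀ j, s (σ j) ≡ t j [ZMOD q] ∨ s (σ j) ≡ -t j [ZMOD q] := by
  have hdet : IsUnit g.det := Matrix.isUnit_det_of_right_inverse
    ((Matrix.mem_orthogonalGroup_iff _ ℝ).1 hg)
  have hsum : g * (rotDiag q s + (rotDiag q s).transpose) * g⁻¹ =
      rotDiag q t + (rotDiag q t).transpose := by
    rw [← h, Matrix.inv_eq_transpose_of_mem_orthogonalGroup hg]
    simp only [Matrix.transpose_mul, Matrix.transpose_transpose, mul_add, add_mul, mul_assoc]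
  rw [rotDiag_add_transpose, rotDiag_add_transpose] at hsum
  obtain ⟨σ, hσ⟩ := exists_perm_of_charpoly_diagonal_eq
    (fun i => 2 * Real.cos (2 * Real.pi * (s i : ℝ) / (q : ℝ)))
    (fun i => 2 * Real.cos (2 * Real.pi * (t i : ℝ) / (q : ℝ)))
    (by
      rw [← hsum]
      exact (Matrix.charpoly_units_conj (Matrix.nonsingInvUnit g hdet) _).symm)
  exact ⟨σ, fun j => modEq_or_modEq_neg_of_cos_eq hq (mul_left_cancel₀ two_ne_zero (hσ j))⟩

/-- Block rotations whose angles agree up to order and sign are orthogonally conjugate. -/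
theorem exists_conj_of_perm_modEq {n q : ℕ} (hq : 0 < q) {s t : Fin n → ℤ}
    (σ : Equiv.Perm (Fin n)) {ε : Fin n → ℤ} (hε : ∀ j, ε j = 1 ∨ ε j = -1)
    (h : ∀ j, s (σ j) ≡ ε j * t j [ZMOD q]) :
    ∃ g ∈ Matrix.orthogonalGroup (Fin 2 × Fin n) ℝ, g * rotDiag q s * g⁻¹ = rotDiag q t := by
  let e : Fin 2 × Fin n ≃ Fin 2 × Fin n := (Equiv.refl _).prodCongr σ
  let P : Matrix (Fin 2 × Fin n) (Fin 2 × Fin n) ℝ := (1 : Matrix _ _ ℝ).submatrix e id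
  let D : Matrix (Fin 2 × Fin n) (Fin 2 × Fin n) ℝ :=
    Matrix.blockDiagonal fun j => Matrix.diagonal ![1, (ε j : ℝ)]
  have hPt : P.transpose = (1 : Matrix _ _ ℝ).submatrix id e := by
    simp [P, Matrix.transpose_submatrix]
  have hDt : D.transpose = D := by
    simp [D]
  have hP : P ∈ Matrix.orthogonalGroup (Fin 2 × Fin n) ℝ := by
    rw [Matrix.mem_orthogonalGroup_iff]
    change P * P.transpose = 1
    rw [hPt]
    ext i j
    simp [P, Matrix.mul_apply, Matrix.one_apply]
  have hD : D ∈ Matrix.orthogonalGroup (Fin 2 × Fin n) ℝ := by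
    rw [Matrix.mem_orthogonalGroup_iff]
    change D * D.transpose = 1
    rw [hDt, ← Matrix.blockDiagonal_mul, ← Matrix.blockDiagonal_one]
    congr 1
    ext1 j
    rcases hε j with h1 | h1 <;> ext a b <;> fin_cases a <;> fin_cases b <;> simp [h1]
  have hPconj : P * rotDiag q s * P.transpose = rotDiag q fun j => s (σ j) := by
    have hsub : P * rotDiag q s * P.transpose = (rotDiag q s).submatrix e e := by
      rw [hPt]
      ext i j
      simp [P, Matrix.mul_apply, Matrix.one_apply]
    rw [hsub]
    ext i j
    simp [rotDiag, Matrix.blockDiagonal_apply, e]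
  have hDconj : D * rotDiag q (fun j => ε j * t j) * D.transpose = rotDiag q t := by
    rw [hDt, rotDiag, rotDiag, ← Matrix.blockDiagonal_mul, ← Matrix.blockDiagonal_mul]
    congr 1
    ext1 j
    rw [← diagonal_sign_conj_rotBlock (hε j) (2 * Real.pi * (t j : ℝ) / (q : ℝ))]
    push_cast
    ring_nf
  refine ⟨D * P, mul_mem hD hP, ?_⟩
  rw [Matrix.inv_eq_transpose_of_mem_orthogonalGroup (mul_mem hD hP), Matrix.transpose_mul,
    ← hDconj, ← (rotDiag_eq_iff hq).2 h, ← hPconj]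
  simp only [mul_assoc]

/-- A family with `gcd(q, s) = 1` detects congruence to zero modulo `q`. -/
theorem dvd_of_forall_dvd_mul {n q : ℕ} {s : Fin n → ℤ}
    (hs : Int.gcd (q : ℤ) (Finset.univ.gcd s) = 1) {a : ℤ} (h : ∀ i, (q : ℤ) ∣ a * s i) :
    (q : ℤ) ∣ a := by
  have h1 : (q : ℤ) ∣ Finset.univ.gcd fun i => a * s i := Finset.dvd_gcd fun i _ => h i
  rw [Finset.gcd_mul_left] at h1
  exact dvd_normalize_iff.1 (Int.dvd_of_dvd_mul_left_of_gcd_one h1 hs)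

/-- **Conjugacy (in O(2n)) of cyclic subgroups of SO(2n).**
For `q ≥ 1` and `s, s' ∈ ℤⁿ` with `gcd(q, s) = gcd(q, s') = 1`, the cyclic subgroups of
`SO(2n)` generated by `γ_{q,s} = diag(R(2πs₁/q), …, R(2πsₙ/q))` and `γ_{q,s'}` are
conjugate by an element of the full orthogonal group `O(2n)` iff
`s_{σ(j)} ≡ ε_j ℓ s'_j (mod q)` for all `j`, for some permutation `σ`, signs
`ε_j ∈ {±1}`, and an integer `ℓ` coprime to `q`. -/
theorem conjugate_cyclic_subgroups_SO_even_iff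
    (n : ℕ) (hn : 1 ≤ n) (q : ℕ) (hq : 0 < q) (s s' : Fin n → ℤ)
    (hs : Int.gcd (q : ℤ) (Finset.univ.gcd s) = 1)
    (hs' : Int.gcd (q : ℤ) (Finset.univ.gcd s') = 1)
    (γ γ' : Matrix (Fin 2 × Fin n) (Fin 2 × Fin n) ℝ)
    (hγ : γ = Matrix.blockDiagonal fun i => rotBlock (2 * Real.pi * (s i : ℝ) / (q : ℝ)))
    (hγ' : γ' = Matrix.blockDiagonal fun i => rotBlock (2 * Real.pi * (s' i : ℝ) / (q : ℝ))) :
    (∃ g : Matrix (Fin 2 × Fin n) (Fin 2 × Fin n) ℝ,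
        g ∈ Matrix.orthogonalGroup (Fin 2 × Fin n) ℝ ∧
          (fun x => g * x * g⁻¹) '' {x | ∃ k : ℕ, x = γ ^ k} = {x | ∃ k : ℕ, x = γ' ^ k}) ↔
      ∃ (σ : Equiv.Perm (Fin n)) (ε : Fin n → ℤ) (ℓ : ℤ),
        (∀ j, ε j = 1 ∨ ε j = -1) ∧ Int.gcd ℓ (q : ℤ) = 1 ∧
          ∀ j, s (σ j) ≡ ε j * ℓ * s' j [ZMOD (q : ℤ)] := by
  change γ = rotDiag q s at hγ
  change γ' = rotDiag q s' at hγ'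
  subst hγ hγ'
  constructor
  · rintro ⟨g, hg, himage⟩
    obtain ⟨l, hl⟩ : ∃ k : ℕ, g * rotDiag q s * g⁻¹ = rotDiag q s' ^ k :=
      himage.subset ⟨rotDiag q s, ⟨1, (pow_one _).symm⟩, rfl⟩
    obtain ⟨_, ⟨m, rfl⟩, hm⟩ := himage.superset ⟨1, (pow_one (rotDiag q s')).symm⟩
    have hlm : rotDiag q s' ^ (l * m) = rotDiag q s' ^ 1 := by
      rw [pow_mul, ← hl, Matrix.conj_pow_of_mem_orthogonalGroup hg, pow_one]
      exact hm
    rw [rotDiag_pow, rotDiag_pow, rotDiag_eq_iff hq] at hlm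
    have hdvd : (q : ℤ) ∣ 1 - l * m := dvd_of_forall_dvd_mul hs' fun i => by
      have := (hlm i).dvd
      push_cast at this
      rwa [← sub_mul] at this
    rw [rotDiag_pow] at hl
    obtain ⟨σ, hσ⟩ := exists_perm_modEq_of_conj hq hg hl
    choose ε hε hmod using fun j =>
      show ∃ ε : ℤ, (ε = 1 ∨ ε = -1) ∧ s (σ j) ≡ ε * l * s' j [ZMOD q] by
        rcases hσ j with h | h
        · exact ⟨1, Or.inl rfl, by simpa using h⟩
        · exact ⟨-1, Or.inr rfl, by simpa using h⟩
    refine ⟨σ, ε, l, hε, ?_, hmod⟩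
    obtain ⟨c, hc⟩ := hdvd
    exact Int.isCoprime_iff_gcd_eq_one.1 ⟨m, c, by linarith⟩
  · rintro ⟨σ, ε, ℓ, hε, hℓ, hmod⟩
    obtain ⟨l, hl⟩ : ∃ l : ℕ, (l : ℤ) ≡ ℓ [ZMOD q] :=
      ⟨(ℓ % q).toNat, by
        rw [Int.toNat_of_nonneg (Int.emod_nonneg _ (by omega))]
        exact Int.mod_modEq _ _⟩
    obtain ⟨m, hm⟩ : ∃ m : ℕ, (l : ℤ) * m ≡ 1 [ZMOD q] := by
      obtain ⟨a, b, hab⟩ := Int.isCoprime_iff_gcd_eq_one.2 hℓ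
      refine ⟨(a % q).toNat, ?_⟩
      rw [Int.toNat_of_nonneg (Int.emod_nonneg _ (by omega))]
      exact (hl.mul (Int.mod_modEq a q)).trans (Int.modEq_iff_dvd.2 ⟨b, by linarith⟩)
    obtain ⟨g, hg, hconj⟩ := exists_conj_of_perm_modEq (t := fun j => l * s' j) hq σ hε
      fun j => (hmod j).trans (by
        rw [← mul_assoc]
        exact ((hl.symm.mul_left _).mul_right _))
    rw [← rotDiag_pow] at hconj
    have hpow : ∀ k, g * rotDiag q s ^ k * g⁻¹ = rotDiag q s' ^ (l * k) := fun k => by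
      rw [← Matrix.conj_pow_of_mem_orthogonalGroup hg, hconj, pow_mul]
    refine ⟨g, hg, Set.Subset.antisymm ?_ ?_⟩
    · rintro _ ⟨_, ⟨k, rfl⟩, rfl⟩
      exact ⟨l * k, hpow k⟩
    · rintro _ ⟨k, rfl⟩
      refine ⟨_, ⟨m * k, rfl⟩, (hpow _).trans ?_⟩
      rw [rotDiag_pow, rotDiag_pow, rotDiag_eq_iff hq]
      intro i
      have := (hm.mul_right (k : ℤ)).mul_right (s' i)
      push_cast
      rwa [one_mul, mul_assoc (l : ℤ)] at this
end

section
/- Let n ≥ 1, let q be a positive integer, and let s ∈ ℤⁿ with gcd(q, s₁, …, sₙ) = 1; set s_{n+1} = −(s₁ + ⋯ + sₙ). Let L* = {(a₁, …, a_{n+1}) ∈ ℤ^{n+1} : a₁ + ⋯ + a_{n+1} = 0 and a₁s₁ + ⋯ + a_{n+1}s_{n+1} ≡ 0 (mod q)}. For k ≥ 0 let N(k) = #{a ∈ L* : |a₁| + ⋯ + |a_{n+1}| = k} (which vanishes for k odd), and let θ(z) = Σ_{k≥0} N(2k) z^k as a formal power series over ℤ. Then there exists a polynomial p(z) with integer coefficients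 of degree strictly less than (n+1)q such that (1 − z^q)^{n+1} · θ(z) = (1 − z) · p(z) as formal power series. -/
open PowerSeries in
/-- The Hadamard (coefficientwise) product of two power series. -/
noncomputable def hadamardProd (F G : PowerSeries ℤ) : PowerSeries ℤ :=
  PowerSeries.mk fun k => coeff k F * coeff k G

open PowerSeries in
theorem coeff_one_sub_X_pow_mul (q k : ℕ) (F : PowerSeries ℤ) :
    coeff k ((1 - X ^ q) * F) = coeff k F - if q ≤ k then coeff (k - q) F else 0 := by
  rw [sub_mul, one_mul, map_sub, coeff_X_pow_mul']

open PowerSeries in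
theorem one_sub_X_pow_mul_hadamardProd (q : ℕ) (F G : PowerSeries ℤ) :
    (1 - X ^ q) * hadamardProd F G =
      hadamardProd F ((1 - X ^ q) * G) + hadamardProd ((1 - X ^ q) * F) (X ^ q * G) := by
  ext k
  simp only [coeff_one_sub_X_pow_mul, hadamardProd, coeff_mk, map_add, coeff_X_pow_mul']
  split_ifs <;> ring

open PowerSeries in
/-- The Hadamard product of `X ^ α / (1 - X ^ q) ^ a` and `X ^ β / (1 - X ^ q) ^ b` has
denominator `(1 - X ^ q) ^ (a + b - 1)` and numerator of degree at most `q * (a - 1) + β`. -/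
theorem exists_numerator_hadamardProd {q : ℕ} (hq : 0 < q) (a b α β : ℕ)
    (F G : PowerSeries ℤ) (hF : (1 - X ^ q) ^ a * F = X ^ α) (hG : (1 - X ^ q) ^ b * G = X ^ β)
    (h : α < β + q * a) :
    ∃ E : Polynomial ℤ, (∀ j, E.coeff j ≠ 0 → j + q ≤ q * a + β) ∧
      (1 - X ^ q) ^ (a + b) * hadamardProd F G = (1 - X ^ q) * (E : PowerSeries ℤ) := by
  induction a generalizing b α β F G with
  | zero =>
    refine ⟨0, by simp, ?_⟩
    have hG0 : coeff α G = 0 := by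
      have hdvd : X ^ β ∣ G := by
        have hu : IsUnit ((1 - X ^ q : PowerSeries ℤ) ^ b) := by
          apply IsUnit.pow
          rw [isUnit_iff_constantCoeff]
          simp [hq.ne']
        rw [← hG]
        exact hu.mul_left_dvd.mpr dvd_rfl
      exact X_pow_dvd_iff.mp hdvd α (by simpa using h)
    have : hadamardProd F G = 0 := by
      ext k
      have hF' : F = X ^ α := by simpa using hF
      simp only [hadamardProd, coeff_mk, hF', coeff_X_pow]
      split_ifs with hk
      · simp [hk, hG0]
      · simp
    simp [this]
  | succ a iha =>
    induction b generalizing β G with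
    | zero =>
      have hG' : G = X ^ β := by simpa using hG
      have hH : hadamardProd F G = C (coeff β F) * X ^ β := by
        ext k
        simp only [hadamardProd, coeff_mk, hG', coeff_X_pow, coeff_C_mul]
        split_ifs with hk
        · simp [hk]
        · simp
      refine ⟨(1 - Polynomial.X ^ q) ^ a * (Polynomial.C (coeff β F) * Polynomial.X ^ β), ?_, ?_⟩
      · intro j hj
        have h1 := Polynomial.le_natDegree_of_ne_zero hj
        have h2 : ((1 - Polynomial.X ^ q : Polynomial ℤ) ^ a *
            (Polynomial.C (coeff β F) * Polynomial.X ^ β)).natDegree ≤ a * q + (0 + β) := by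
          refine Polynomial.natDegree_mul_le_of_le ?_ ?_
          · refine Polynomial.natDegree_pow_le_of_le a ?_
            refine (Polynomial.natDegree_sub_le _ _).trans ?_
            simp
          · exact Polynomial.natDegree_mul_le_of_le (by simp) (by simp)
        nlinarith
      · rw [hH]
        simp only [Polynomial.coe_mul, Polynomial.coe_pow, Polynomial.coe_sub, Polynomial.coe_one,
          Polynomial.coe_X, Polynomial.coe_C]
        ring
    | succ b ihb =>
      obtain ⟨E₁, hE₁, h₁⟩ := ihb β ((1 - X ^ q) * G) (by rw [← hG]; ring) h
      obtain ⟨E₂, hE₂, h₂⟩ := iha (b + 1) α (β + q) ((1 - X ^ q) * F) (X ^ q * G)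
        (by rw [← hF]; ring) (by rw [pow_add X β q, ← hG]; ring) (by rw [mul_add] at h; omega)
      refine ⟨E₁ + E₂, ?_, ?_⟩
      · intro j hj
        rw [Polynomial.coeff_add] at hj
        by_cases h0 : E₁.coeff j = 0
        · have := hE₂ j (by simpa [h0] using hj)
          rw [mul_add]; omega
        · exact hE₁ j h0
      · calc (1 - X ^ q) ^ (a + 1 + (b + 1)) * hadamardProd F G
            = (1 - X ^ q) ^ (a + 1 + b) * ((1 - X ^ q) * hadamardProd F G) := by ring
          _ = (1 - X ^ q) ^ (a + 1 + b) * hadamardProd F ((1 - X ^ q) * G) +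
              (1 - X ^ q) ^ (a + (b + 1)) * hadamardProd ((1 - X ^ q) * F) (X ^ q * G) := by
                rw [one_sub_X_pow_mul_hadamardProd]; ring
          _ = _ := by rw [h₁, h₂, Polynomial.coe_add]; ring

open PowerSeries in
/-- The generating series of the natural numbers in the residue class `r`. -/
def residueSeries (q : ℕ) (r : ZMod q) : PowerSeries ℤ :=
  PowerSeries.mk fun j => if (j : ZMod q) = r then 1 else 0

open PowerSeries in
/-- The generating series of the positive `j` such that `-j` lies in the residue class `r`. -/
def negResidueSeries (q : ℕ) (r : ZMod q) : PowerSeries ℤ :=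
  PowerSeries.mk fun j => if 0 < j ∧ -(j : ZMod q) = r then 1 else 0

theorem natCast_eq_iff_eq_val {q : ℕ} [NeZero q] (r : ZMod q) {j : ℕ} (hj : j < q) :
    (j : ZMod q) = r ↔ j = r.val := by
  constructor
  · rintro rfl
    rw [ZMod.val_natCast, Nat.mod_eq_of_lt hj]
  · rintro rfl
    simp

open PowerSeries in
theorem one_sub_X_pow_mul_residueSeries (q : ℕ) [NeZero q] (r : ZMod q) :
    (1 - X ^ q) * residueSeries q r = X ^ r.val := by
  ext j
  have hr := r.val_lt
  simp only [coeff_one_sub_X_pow_mul, residueSeries, coeff_mk, coeff_X_pow]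
  by_cases hj : q ≤ j
  · have hne : j ≠ r.val := by omega
    simp [hj, Nat.cast_sub hj, hne]
  · simp [hj, natCast_eq_iff_eq_val r (not_le.mp hj)]

open PowerSeries in
theorem one_sub_X_pow_mul_negResidueSeries (q : ℕ) [NeZero q] (r : ZMod q) :
    (1 - X ^ q) * negResidueSeries q r = X ^ (q - r.val) := by
  ext j
  have hr := r.val_lt
  simp only [coeff_one_sub_X_pow_mul, negResidueSeries, coeff_mk, coeff_X_pow]
  rcases lt_trichotomy j q with hj | rfl | hj
  · have key : (0 < j ∧ -(j : ZMod q) = r) ↔ j = q - r.val := by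
      rcases Nat.eq_zero_or_pos j with rfl | h0
      · simp; omega
      · have : -(j : ZMod q) = ((q - j : ℕ) : ZMod q) := by
          rw [Nat.cast_sub hj.le]; simp
        rw [this, natCast_eq_iff_eq_val r (by omega)]
        omega
    simp [key, not_le.mpr hj]
  · have h0 : 0 < j := Nat.pos_of_ne_zero (NeZero.ne j)
    have key : (0 : ZMod j) = r ↔ j = j - r.val := by
      rw [eq_comm, ← ZMod.val_eq_zero]; omega
    simp [key, h0]
  · have hne : j ≠ q - r.val := by omega
    simp [hj.le, Nat.cast_sub hj.le, hne, hj, Nat.zero_lt_of_lt hj]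

open PowerSeries in
/-- The generating series, by sum of positive parts, of the integer vectors of coordinate sum `0`
in the residue class `r` whose set of nonnegative coordinates is `P`. -/
noncomputable def orthantSeries {ι : Type*} [Fintype ι] [DecidableEq ι] (q : ℕ) (r : ι → ZMod q)
    (P : Finset ι) : PowerSeries ℤ :=
  hadamardProd (∏ i ∈ P, residueSeries q (r i)) (∏ i ∈ Pᶜ, negResidueSeries q (r i))

open PowerSeries in
theorem exists_numerator_orthantSeries {ι : Type*} [Fintype ι] [Nonempty ι] [DecidableEq ι]
    (q : ℕ) [NeZero q] (r : ι → ZMod q) (P : Finset ι) :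
    ∃ E : Polynomial ℤ, (∀ j, E.coeff j ≠ 0 → j + q ≤ q * Fintype.card ι) ∧
      (1 - X ^ q) ^ Fintype.card ι * orthantSeries q r P =
        (1 - X ^ q) * (E : PowerSeries ℤ) := by
  have hle : ∑ i ∈ Pᶜ, (q - (r i).val) ≤ q * Pᶜ.card := by
    rw [mul_comm]
    exact Finset.sum_le_card_nsmul _ _ _ fun i _ => Nat.sub_le _ _
  have hcard : P.card + Pᶜ.card = Fintype.card ι := Finset.card_add_card_compl P
  have hF : (1 - X ^ q) ^ P.card * ∏ i ∈ P, residueSeries q (r i) =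
      X ^ ∑ i ∈ P, (r i).val := by
    rw [← Finset.prod_const, ← Finset.prod_mul_distrib, ← Finset.prod_pow_eq_pow_sum]
    exact Finset.prod_congr rfl fun i _ => one_sub_X_pow_mul_residueSeries q (r i)
  have hG : (1 - X ^ q) ^ Pᶜ.card * ∏ i ∈ Pᶜ, negResidueSeries q (r i) =
      X ^ ∑ i ∈ Pᶜ, (q - (r i).val) := by
    rw [← Finset.prod_const, ← Finset.prod_mul_distrib, ← Finset.prod_pow_eq_pow_sum]
    exact Finset.prod_congr rfl fun i _ => one_sub_X_pow_mul_negResidueSeries q (r i)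
  have hlt : ∑ i ∈ P, (r i).val < ∑ i ∈ Pᶜ, (q - (r i).val) + q * P.card := by
    rcases P.eq_empty_or_nonempty with rfl | hP
    · simp only [Finset.sum_empty, Finset.card_empty, mul_zero, add_zero, Finset.compl_empty]
      exact Finset.sum_pos (fun i _ => Nat.sub_pos_of_lt (r i).val_lt) Finset.univ_nonempty
    · have : ∑ i ∈ P, (r i).val < ∑ i ∈ P, q :=
        Finset.sum_lt_sum_of_nonempty hP fun i _ => (r i).val_lt
      rw [Finset.sum_const, smul_eq_mul, mul_comm] at this
      omega
  obtain ⟨E, hE, h⟩ := exists_numerator_hadamardProd (Nat.pos_of_ne_zero (NeZero.ne q))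
    P.card Pᶜ.card _ _ _ _ hF hG hlt
  refine ⟨E, fun j hj => (hE j hj).trans ?_, by rw [← hcard]; exact h⟩
  rw [← hcard, mul_add]
  omega

open PowerSeries in
theorem coeff_prod_mk_ite {ι : Type*} [DecidableEq ι] (S : Finset ι) (p : ι → ℕ → Prop)
    [∀ i, DecidablePred (p i)] (k : ℕ) :
    coeff k (∏ i ∈ S, (PowerSeries.mk fun j => if p i j then (1 : ℤ) else 0)) =
      (((S.finsuppAntidiag k).filter fun l => ∀ i ∈ S, p i (l i)).card : ℤ) := by
  rw [coeff_prod, Finset.card_filter, Nat.cast_sum]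
  refine Finset.sum_congr rfl fun l _ => ?_
  simp only [coeff_mk]
  rw [Finset.prod_ite_zero]
  simp

open PowerSeries in
theorem coeff_orthantSeries {ι : Type*} [Fintype ι] [DecidableEq ι] (q : ℕ) (r : ι → ZMod q)
    (P : Finset ι) (k : ℕ) :
    coeff k (orthantSeries q r P) =
      (Set.ncard {a : ι → ℤ | (∑ i, a i) = 0 ∧ (∑ i, (a i).natAbs) = 2 * k ∧
        (∀ i, (a i : ZMod q) = r i) ∧ ∀ i, i ∈ P ↔ 0 ≤ a i} : ℤ) := by
  simp only [orthantSeries, hadamardProd, coeff_mk, residueSeries, negResidueSeries]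
  rw [coeff_prod_mk_ite, coeff_prod_mk_ite, ← Nat.cast_mul, ← Finset.card_product,
    ← Set.ncard_coe_finset]
  congr 1
  have key : ∀ a : ι → ℤ, ((∑ i, a i) = 0 ∧ (∑ i, (a i).natAbs) = 2 * k) ↔
      (∑ i, (a i).toNat = k ∧ ∑ i, (-a i).toNat = k) := by
    intro a
    have h1 : ∑ i, a i = (∑ i, (a i).toNat : ℕ) - (∑ i, (-a i).toNat : ℕ) := by
      push_cast
      rw [← Finset.sum_sub_distrib]
      exact Finset.sum_congr rfl fun i _ => by omega
    have h2 : ∑ i, (a i).natAbs = ∑ i, (a i).toNat + ∑ i, (-a i).toNat := by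
      rw [← Finset.sum_add_distrib]
      exact Finset.sum_congr rfl fun i _ => by omega
    omega
  symm
  refine Set.ncard_congr (fun a _ => (Finsupp.equivFunOnFinite.symm fun i => (a i).toNat,
    Finsupp.equivFunOnFinite.symm fun i => (-a i).toNat)) ?_ ?_ ?_
  · rintro a ⟨h0, hk, hr, hP⟩
    obtain ⟨hk1, hk2⟩ := (key a).mp ⟨h0, hk⟩
    have hs1 : ∑ i ∈ P, (a i).toNat = ∑ i, (a i).toNat :=
      Finset.sum_subset (Finset.subset_univ _) fun i _ hi => by rw [hP] at hi; omega
    have hs2 : ∑ i ∈ Pᶜ, (-a i).toNat = ∑ i, (-a i).toNat :=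
      Finset.sum_subset (Finset.subset_univ _) fun i _ hi => by
        rw [Finset.mem_compl, not_not, hP] at hi; omega
    simp only [Finset.coe_product, Set.mem_prod, Finset.mem_coe, Finset.mem_filter,
      Finset.mem_finsuppAntidiag, Finsupp.equivFunOnFinite_symm_apply_apply]
    refine ⟨⟨⟨hs1.trans hk1, ?_⟩, ?_⟩, ⟨hs2.trans hk2, ?_⟩, ?_⟩
    · intro i hi
      simp at hi
      rw [hP]; omega
    · intro i hi
      rw [hP] at hi
      rw [← hr, ← Int.cast_natCast, Int.toNat_of_nonneg hi]
    · intro i hi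
      simp at hi
      rw [Finset.mem_compl, hP]; omega
    · intro i hi
      rw [Finset.mem_compl, hP] at hi
      refine ⟨by omega, ?_⟩
      rw [← hr, ← Int.cast_natCast, Int.toNat_of_nonneg (by omega)]
      simp
  · intro a b _ _ hab
    simp only [Prod.mk.injEq, EmbeddingLike.apply_eq_iff_eq] at hab
    funext i
    have h1 := congrFun hab.1 i
    have h2 := congrFun hab.2 i
    omega
  · rintro ⟨l, l'⟩ hl
    simp only [Finset.coe_product, Set.mem_prod, Finset.mem_coe, Finset.mem_filter,
      Finset.mem_finsuppAntidiag] at hl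
    obtain ⟨⟨⟨hk1, hs1⟩, hr1⟩, ⟨hk2, hs2⟩, hr2⟩ := hl
    have hz1 : ∀ i, i ∉ P → l i = 0 := fun i hi => by
      by_contra hne
      exact hi (hs1 (Finsupp.mem_support_iff.mpr hne))
    have hz2 : ∀ i, i ∈ P → l' i = 0 := fun i hi => by
      by_contra hne
      exact Finset.mem_compl.mp (hs2 (Finsupp.mem_support_iff.mpr hne)) hi
    have ht1 : ∀ i, ((l i : ℤ) - l' i).toNat = l i := fun i => by
      by_cases hi : i ∈ P
      · have := hz2 i hi; omega
      · have := hz1 i hi; omega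
    have ht2 : ∀ i, (-((l i : ℤ) - l' i)).toNat = l' i := fun i => by
      by_cases hi : i ∈ P
      · have := hz2 i hi; omega
      · have := hz1 i hi; omega
    refine ⟨fun i => (l i : ℤ) - l' i, ?_, ?_⟩
    · rw [Set.mem_ofPred_eq, ← and_assoc, key]
      simp only [ht1, ht2]
      refine ⟨⟨?_, ?_⟩, fun i => ?_, fun i => ?_⟩
      · rw [← hk1]
        exact (Finset.sum_subset (Finset.subset_univ _) fun i _ hi => hz1 i hi).symm
      · rw [← hk2]
        exact (Finset.sum_subset (Finset.subset_univ _) fun i _ hi =>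
          hz2 i (by simpa using hi)).symm
      · by_cases hi : i ∈ P
        · simpa [hz2 i hi] using hr1 i hi
        · simpa [hz1 i hi] using (hr2 i (Finset.mem_compl.mpr hi)).2
      · by_cases hi : i ∈ P
        · simp [hz2 i hi, hi]
        · have := (hr2 i (Finset.mem_compl.mpr hi)).1
          simp [hz1 i hi, hi]; omega
    · ext i
      · simp [ht1]
      · simpa using ht2 i

theorem finite_sum_natAbs_eq {ι : Type*} [Fintype ι] (k : ℕ) :
    {a : ι → ℤ | (∑ i, (a i).natAbs) = k}.Finite := by
  classical
  refine (Fintype.piFinset fun _ : ι => Finset.Icc (-(k : ℤ)) k).finite_toSet.subset ?_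
  intro a ha
  simp only [Finset.mem_coe, Fintype.mem_piFinset, Finset.mem_Icc]
  intro i
  have : (a i).natAbs ≤ k := by
    rw [← show (∑ i, (a i).natAbs) = k from ha]
    exact Finset.single_le_sum (f := fun i => (a i).natAbs) (fun _ _ => Nat.zero_le _)
      (Finset.mem_univ i)
  omega

open PowerSeries in
/-- The theta series of a congruence sublattice of `A_n`, split by residue classes and signs. -/
theorem mk_ncard_eq_sum_orthantSeries {ι : Type*} [Fintype ι] [DecidableEq ι] (q : ℕ) [NeZero q]
    (t : ι → ℤ) :
    (PowerSeries.mk fun k => (Set.ncard {a : ι → ℤ | (∑ i, a i) = 0 ∧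
      (q : ℤ) ∣ (∑ i, a i * t i) ∧ (∑ i, (a i).natAbs) = 2 * k} : ℤ)) =
    ∑ x : (ι → ZMod q) × Finset ι with ∑ i, x.1 i * (t i : ZMod q) = 0, orthantSeries q x.1 x.2 := by
  ext k
  rw [coeff_mk, map_sum]
  have hfin : {a : ι → ℤ | (∑ i, a i) = 0 ∧
      (q : ℤ) ∣ (∑ i, a i * t i) ∧ (∑ i, (a i).natAbs) = 2 * k}.Finite :=
    (finite_sum_natAbs_eq (2 * k)).subset fun a ha => ha.2.2
  have hdvd : ∀ a : ι → ℤ, (q : ℤ) ∣ (∑ i, a i * t i) ↔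
      ∑ i, (a i : ZMod q) * (t i : ZMod q) = 0 := fun a => by
    rw [← ZMod.intCast_zmod_eq_zero_iff_dvd]
    push_cast
    rfl
  rw [Set.ncard_eq_toFinset_card _ hfin, Finset.card_eq_sum_card_fiberwise
    (f := fun a => ((fun i => (a i : ZMod q)), Finset.univ.filter fun i => 0 ≤ a i))
    (t := Finset.univ.filter fun x : (ι → ZMod q) × Finset ι => ∑ i, x.1 i * (t i : ZMod q) = 0), Nat.cast_sum]
  · refine Finset.sum_congr rfl fun x hx => ?_
    rw [coeff_orthantSeries, ← Set.ncard_coe_finset]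
    congr 2
    ext a
    rw [Finset.mem_filter] at hx
    simp only [Finset.coe_filter, Set.Finite.mem_toFinset, Set.mem_ofPred_eq, Prod.ext_iff,
      funext_iff, Finset.ext_iff, Finset.mem_filter, Finset.mem_univ, true_and, hdvd]
    constructor
    · rintro ⟨⟨h0, -, hk⟩, hr, hP⟩
      exact ⟨h0, hk, hr, fun i => (hP i).symm⟩
    · rintro ⟨h0, hk, hr, hP⟩
      refine ⟨⟨h0, ?_, hk⟩, hr, fun i => (hP i).symm⟩
      simpa only [hr] using hx.2
  · intro a ha
    simp only [Set.Finite.coe_toFinset, Set.mem_ofPred_eq, hdvd] at ha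
    simpa using ha.2.1

/-- **Ehrhart-type rationality of the theta function of the `SU(n+1)` congruence lattice.**
With `s_{n+1} = -(s₁ + ⋯ + sₙ)`, let
`L* = {a ∈ ℤ^{n+1} : Σᵢ aᵢ = 0, Σᵢ aᵢsᵢ ≡ 0 (mod q)}`, let `N(k) = #{a ∈ L* : ‖a‖₁ = k}`
and `θ(z) = Σ_k N(2k) z^k`.  Then there is an integer polynomial `p` of degree `< (n+1)q`
with `(1 - z^q)^{n+1} θ(z) = (1 - z) p(z)`. -/
theorem theta_congruence_lattice_SU_rational
    (n : ℕ) (hn : 1 ≤ n) (q : ℕ) (hq : 0 < q) (s : Fin n → ℤ)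
    (hs : Int.gcd (q : ℤ) (Finset.univ.gcd s) = 1)
    (sF : Fin (n + 1) → ℤ) (hsF : sF = Fin.snoc s (-(∑ i, s i)))
    (N : ℕ → ℕ)
    (hN : ∀ k, N k = Set.ncard {a : Fin (n + 1) → ℤ |
        (∑ i, a i) = 0 ∧ (q : ℤ) ∣ (∑ i, a i * sF i) ∧ (∑ i, (a i).natAbs) = k})
    (θ : PowerSeries ℤ) (hθ : θ = PowerSeries.mk fun k => (N (2 * k) : ℤ)) :
    ∃ p : Polynomial ℤ, p.degree < ((n + 1) * q : ℕ) ∧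
      (1 - PowerSeries.X ^ q) ^ (n + 1) * θ = (1 - PowerSeries.X) * (p : PowerSeries ℤ) := by
  subst hθ
  have : NeZero q := ⟨hq.ne'⟩
  simp only [hN]
  rw [mk_ncard_eq_sum_orthantSeries q sF]
  choose E hE hEq using fun x : (Fin (n + 1) → ZMod q) × Finset (Fin (n + 1)) =>
    exists_numerator_orthantSeries q x.1 x.2
  simp only [Fintype.card_fin] at hE hEq
  set S : Finset ((Fin (n + 1) → ZMod q) × Finset (Fin (n + 1))) :=
    Finset.univ.filter fun x => ∑ i, x.1 i * (sF i : ZMod q) = 0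
  have hsum : (∑ x ∈ S, E x).natDegree ≤ q * n := by
    refine Polynomial.natDegree_sum_le_of_forall_le S E fun x _ => ?_
    refine Polynomial.natDegree_le_iff_coeff_eq_zero.mpr fun j hj => ?_
    by_contra hne
    have := hE x j hne
    rw [mul_add] at this
    omega
  have hgeom : (∑ i ∈ Finset.range q, (Polynomial.X : Polynomial ℤ) ^ i).natDegree ≤ q - 1 :=
    Polynomial.natDegree_sum_le_of_forall_le _ _ fun i hi => by
      have := Finset.mem_range.mp hi
      simp only [Polynomial.natDegree_X_pow]
      omega
  refine ⟨(∑ i ∈ Finset.range q, Polynomial.X ^ i) * ∑ x ∈ S, E x, ?_, ?_⟩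
  · refine Polynomial.degree_le_natDegree.trans_lt (Nat.cast_lt.mpr ?_)
    refine (Polynomial.natDegree_mul_le_of_le hgeom hsum).trans_lt ?_
    rw [add_mul, mul_comm n q]
    omega
  · have hX : (1 - PowerSeries.X) * ((∑ i ∈ Finset.range q, Polynomial.X ^ i : Polynomial ℤ) :
        PowerSeries ℤ) = 1 - PowerSeries.X ^ q := by
      have := congrArg (fun p : Polynomial ℤ => (p : PowerSeries ℤ))
        (mul_neg_geom_sum (Polynomial.X : Polynomial ℤ) q)
      simpa only [Polynomial.coe_mul, Polynomial.coe_sub, Polynomial.coe_one, Polynomial.coe_X,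
        Polynomial.coe_pow] using this
    rw [Polynomial.coe_mul, ← mul_assoc, hX, Finset.mul_sum, Finset.sum_congr rfl fun x _ => hEq x,
      ← Finset.mul_sum]
    congr 1
    exact (map_sum (Polynomial.coeToPowerSeries.ringHom) E S).symm
end
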